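/- arXiv:2105.13576 — 3 statements merged into one kernel-verified Lean document; each statement's English description precedes it below -/
import Mathlib

section
/- For every n ≥ 1 and every τ ∈ (0, π), the set Γ_τ = {λ ∈ ℝ^n : θ(λ) < τ} is a convex subset of ℝ^n. -/
open Real

/-- `arccot x = π/2 − arctan x`, taking values in `(0, π)`. -/
noncomputable def arccot (x : ℝ) : ℝ := π / 2 - arctan x

/-- `θ(λ) = Σ_{i=1}^n arccot(λ_i)`. -/
noncomputable def theta {n : ℕ} (lam : Fin n → ℝ) : ℝ := ∑ i, arccot (lam i)

theorem arccot_pos (x : ℝ) : 0 < arccot x := by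
  have := arctan_lt_pi_div_two x
  unfold arccot
  linarith

theorem arccot_lt_pi (x : ℝ) : arccot x < π := by
  have := neg_pi_div_two_lt_arctan x
  unfold arccot
  linarith

theorem arccot_strictAnti : StrictAnti arccot := fun _ _ h =>
  sub_lt_sub_left (arctan_strictMono h) _

theorem exists_arccot_eq {t : ℝ} (h0 : 0 < t) (h1 : t < π) : ∃ x, arccot x = t := by
  refine ⟨tan (π / 2 - t), ?_⟩
  rw [arccot, arctan_tan (by linarith) (by linarith)]
  ring

theorem add_pos_of_arccot_add_lt_pi {x y : ℝ} (h : arccot x + arccot y < π) : 0 < x + y := by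
  have : arctan (-y) < arctan x := by
    unfold arccot at h
    rw [arctan_neg]
    linarith
  linarith [arctan_strictMono.lt_iff_lt.1 this]

/-- The addition formula for the inverse cotangent. -/
theorem arccot_add_arccot {x y : ℝ} (h : 0 < x + y) :
    arccot x + arccot y = arccot ((x * y - 1) / (x + y)) := by
  have hpos : 0 < arctan x + arctan y := by
    have : arctan (-y) < arctan x := arctan_strictMono (by linarith)
    rw [arctan_neg] at this
    linarith
  have hlt : arctan x + arctan y < π := by
    linarith [arctan_lt_pi_div_two x, arctan_lt_pi_div_two y]
  have htan : tan (arctan x + arctan y - π / 2) = (x * y - 1) / (x + y) := by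
    have hx := (cos_arctan_pos x).ne'
    have hy := (cos_arctan_pos y).ne'
    have hsx : sin (arctan x) = x * cos (arctan x) := by
      rw [← tan_mul_cos hx, tan_arctan]
    have hsy : sin (arctan y) = y * cos (arctan y) := by
      rw [← tan_mul_cos hy, tan_arctan]
    rw [tan_eq_sin_div_cos, sin_sub_pi_div_two, cos_sub_pi_div_two, sin_add, cos_add, hsx, hsy]
    have hd : x * cos (arctan x) * cos (arctan y) + cos (arctan x) * (y * cos (arctan y)) =
        (x + y) * (cos (arctan x) * cos (arctan y)) := by ring
    rw [hd]
    field_simp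
    ring
  unfold arccot
  rw [← htan, arctan_tan (by linarith) (by linarith)]
  ring

/-- Concavity of `(x, y) ↦ (x * y - 1) / (x + y)` on the half-plane `0 < x + y`. -/
theorem mul_sub_one_div_add_concave {x y x' y' a b : ℝ} (h : 0 < x + y) (h' : 0 < x' + y')
    (ha : 0 ≤ a) (hb : 0 ≤ b) (hab : a + b = 1) :
    a * ((x * y - 1) / (x + y)) + b * ((x' * y' - 1) / (x' + y')) ≤
      ((a * x + b * x') * (a * y + b * y') - 1) / ((a * x + b * x') + (a * y + b * y')) := by
  have hS : 0 < (a * x + b * x') + (a * y + b * y') := by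
    have h1 : 0 < a * (x + y) + b * (x' + y') := by
      rcases ha.eq_or_lt with rfl | ha
      · obtain rfl : b = 1 := by linarith
        linarith
      · positivity
    linarith
  have key : ((a * x + b * x') * (a * y + b * y') - 1) / ((a * x + b * x') + (a * y + b * y')) -
      (a * ((x * y - 1) / (x + y)) + b * ((x' * y' - 1) / (x' + y'))) =
      a * b * ((y * x' - y' * x) ^ 2 + ((x + y) - (x' + y')) ^ 2) /
        ((x + y) * (x' + y') * ((a * x + b * x') + (a * y + b * y'))) := by
    obtain rfl : b = 1 - a := by linarith
    field_simp
    ring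
  have : 0 ≤ a * b * ((y * x' - y' * x) ^ 2 + ((x + y) - (x' + y')) ^ 2) /
        ((x + y) * (x' + y') * ((a * x + b * x') + (a * y + b * y'))) := by positivity
  linarith

/-- Concavity of `cot ∘ theta` on the set `theta < π`. -/
theorem theta_combo_le {a b : ℝ} (ha : 0 ≤ a) (hb : 0 ≤ b) (hab : a + b = 1) (n : ℕ) :
    ∀ (lam mu : Fin (n + 1) → ℝ) (u v : ℝ), theta lam = arccot u → theta mu = arccot v →
      theta (a • lam + b • mu) ≤ arccot (a * u + b * v) := by
  induction n with
  | zero =>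
    intro lam mu u v hu hv
    simp only [theta, Nat.reduceAdd, Fin.sum_univ_one] at hu hv ⊢
    rw [← arccot_strictAnti.injective hu, ← arccot_strictAnti.injective hv]
    simp
  | succ n ih =>
    have split (lam : Fin (n + 2) → ℝ) : theta lam = arccot (lam 0) + theta (Fin.tail lam) :=
      Fin.sum_univ_succ _
    have decomp (lam : Fin (n + 2) → ℝ) (u : ℝ) (hu : theta lam = arccot u) :
        ∃ y, theta (Fin.tail lam) = arccot y ∧ 0 < lam 0 + y ∧
          u = (lam 0 * y - 1) / (lam 0 + y) := by
      rw [split] at hu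
      have hlt := arccot_lt_pi u
      obtain ⟨y, hy⟩ := exists_arccot_eq (t := theta (Fin.tail lam))
        (Finset.sum_pos (fun i _ => arccot_pos _) Finset.univ_nonempty)
        (by linarith [arccot_pos (lam 0)])
      rw [← hy] at hu
      have hpos := add_pos_of_arccot_add_lt_pi (hu.trans_lt hlt)
      exact ⟨y, hy.symm, hpos,
        arccot_strictAnti.injective (hu.symm.trans (arccot_add_arccot hpos))⟩
    intro lam mu u v hu hv
    obtain ⟨y, hy, hpos, rfl⟩ := decomp lam u hu
    obtain ⟨y', hy', hpos', rfl⟩ := decomp mu v hv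
    have hS : 0 < (a * lam 0 + b * mu 0) + (a * y + b * y') := by
      have h1 : 0 < a * (lam 0 + y) + b * (mu 0 + y') := by
        rcases ha.eq_or_lt with rfl | ha
        · obtain rfl : b = 1 := by linarith
          linarith
        · positivity
      linarith
    calc theta (a • lam + b • mu)
        = arccot (a * lam 0 + b * mu 0) + theta (a • Fin.tail lam + b • Fin.tail mu) := split _
      _ ≤ arccot (a * lam 0 + b * mu 0) + arccot (a * y + b * y') := by
        gcongr
        exact ih _ _ _ _ hy hy'
      _ = _ := arccot_add_arccot hS
      _ ≤ _ := arccot_strictAnti.antitone (mul_sub_one_div_add_concave hpos hpos' ha hb hab)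

theorem stmt3 (n : ℕ) (hn : 1 ≤ n) (τ : ℝ) (hτ0 : 0 < τ) (hτπ : τ < π) :
    Convex ℝ {lam : Fin n → ℝ | theta lam < τ} := by
  obtain ⟨n, rfl⟩ := Nat.exists_eq_add_of_le' hn
  obtain ⟨w, rfl⟩ := exists_arccot_eq hτ0 hτπ
  intro lam hlam mu hmu a b ha hb hab
  simp only [Set.mem_ofPred_eq] at hlam hmu ⊢
  have hpos (lam : Fin (n + 1) → ℝ) : 0 < theta lam :=
    Finset.sum_pos (fun i _ => arccot_pos _) Finset.univ_nonempty
  obtain ⟨u, hu⟩ := exists_arccot_eq (hpos lam) (hlam.trans hτπ)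
  obtain ⟨v, hv⟩ := exists_arccot_eq (hpos mu) (hmu.trans hτπ)
  refine (theta_combo_le ha hb hab n lam mu u v hu.symm hv.symm).trans_lt (arccot_strictAnti ?_)
  rw [← hu] at hlam
  rw [← hv] at hmu
  exact convex_Ioi w (arccot_strictAnti.lt_iff_gt.1 hlam) (arccot_strictAnti.lt_iff_gt.1 hmu)
    ha hb hab
end

section
/- For every n ≥ 1 and every τ ∈ (0, π), the function λ ↦ cot(θ(λ)) = cos(θ(λ))/sin(θ(λ)) is concave on the convex set Γ_τ = {λ ∈ ℝ^n : θ(λ) < τ} (note that 0 < θ(λ) < τ < π on Γ_τ, so sin(θ(λ)) > 0 and cot(θ(λ)) is well defined there). -/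
open Real

theorem cos_div_sin_arccot (x : ℝ) : cos (arccot x) / sin (arccot x) = x := by
  rw [arccot, cos_pi_div_two_sub, sin_pi_div_two_sub, ← tan_eq_sin_div_cos, tan_arctan]

theorem theta_succ {n : ℕ} (x : Fin (n + 1) → ℝ) :
    theta x = theta (fun i => x (Fin.castSucc i)) + arccot (x (Fin.last n)) :=
  Fin.sum_univ_castSucc _

theorem theta_pos {n : ℕ} (x : Fin (n + 1) → ℝ) : 0 < theta x :=
  Finset.sum_pos (fun i _ => arccot_pos (x i)) Finset.univ_nonempty

theorem cot_add_cot {α β : ℝ} (hα : sin α ≠ 0) (hβ : sin β ≠ 0) :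
    cos α / sin α + cos β / sin β = sin (α + β) / (sin α * sin β) := by
  rw [sin_add]; field_simp; ring

/-- For angles in `(0, π)`, the sum stays below `π` iff the sum of the cotangents is positive. -/
theorem add_lt_pi_iff {α β : ℝ} (hα0 : 0 < α) (hα : α < π) (hβ0 : 0 < β) (hβ : β < π) :
    α + β < π ↔ 0 < cos α / sin α + cos β / sin β := by
  have h1 := sin_pos_of_pos_of_lt_pi hα0 hα
  have h2 := sin_pos_of_pos_of_lt_pi hβ0 hβ
  rw [cot_add_cot h1.ne' h2.ne', div_pos_iff_of_pos_right (mul_pos h1 h2)]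
  refine ⟨fun h => sin_pos_of_pos_of_lt_pi (by linarith) h, fun h => ?_⟩
  by_contra! hc
  have : 0 ≤ sin (α + β - π) := sin_nonneg_of_nonneg_of_le_pi (by linarith) (by linarith)
  rw [sin_sub_pi] at this
  linarith

theorem cot_add {α β : ℝ} (hα : sin α ≠ 0) (hβ : sin β ≠ 0) (h : sin (α + β) ≠ 0) :
    cos (α + β) / sin (α + β) =
      cos β / sin β - ((cos β / sin β) ^ 2 + 1) / (cos α / sin α + cos β / sin β) := by
  rw [cot_add_cot hα hβ]
  have e : (cos β / sin β) ^ 2 + 1 = 1 / sin β ^ 2 := by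
    field_simp; exact cos_sq_add_sin_sq β
  rw [e]
  field_simp
  have e1 : sin α = sin (α + β) * cos β - cos (α + β) * sin β := by
    rw [← sin_sub]; congr 1; ring
  linarith

/-- The cotangent is strictly decreasing on `(0, π)`. -/
theorem lt_iff_cot_lt {α β : ℝ} (hα0 : 0 < α) (hα : α < π) (hβ0 : 0 < β) (hβ : β < π) :
    α < β ↔ cos β / sin β < cos α / sin α := by
  have h := add_lt_pi_iff hα0 hα (β := π - β) (by linarith) (by linarith)
  rw [cos_pi_sub, sin_pi_sub, neg_div] at h
  constructor
  · intro h'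
    linarith [h.1 (by linarith)]
  · intro h'
    linarith [h.2 (by linarith)]

/-- Joint convexity of `(s, p) ↦ (s ^ 2 + 1) / p` for `p > 0`, combined with monotonicity in `p`. -/
theorem sq_add_one_div_le {a b s t p q r : ℝ} (ha : 0 ≤ a) (hb : 0 ≤ b) (hab : a + b = 1)
    (hp : 0 < p) (hq : 0 < q) (hr : a * p + b * q ≤ r) :
    ((a * s + b * t) ^ 2 + 1) / r ≤ a * ((s ^ 2 + 1) / p) + b * ((t ^ 2 + 1) / q) := by
  have hpos : 0 < a * p + b * q := by
    rcases ha.eq_or_lt with rfl | ha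
    · have : b = 1 := by linarith
      subst this; linarith
    · nlinarith [mul_pos ha hp, mul_nonneg hb hq.le]
  refine (div_le_div_of_nonneg_left (by positivity) hpos hr).trans ?_
  rw [div_le_iff₀ hpos]
  have key : 2 * (s * t + 1) ≤ (s ^ 2 + 1) / p * q + (t ^ 2 + 1) / q * p := by
    have e : (s ^ 2 + 1) / p * q + (t ^ 2 + 1) / q * p - 2 * (s * t + 1) =
        ((s * q - t * p) ^ 2 + (q - p) ^ 2) / (p * q) := by
      field_simp; ring
    have : 0 ≤ ((s * q - t * p) ^ 2 + (q - p) ^ 2) / (p * q) := by positivity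
    linarith
  have e1 : (s ^ 2 + 1) / p * p = s ^ 2 + 1 := div_mul_cancel₀ _ hp.ne'
  have e2 : (t ^ 2 + 1) / q * q = t ^ 2 + 1 := div_mul_cancel₀ _ hq.ne'
  calc (a * s + b * t) ^ 2 + 1 = (a * s + b * t) ^ 2 + (a + b) ^ 2 := by rw [hab]; ring
    _ = a ^ 2 * (s ^ 2 + 1) + b ^ 2 * (t ^ 2 + 1) + a * b * (2 * (s * t + 1)) := by ring
    _ ≤ a ^ 2 * (s ^ 2 + 1) + b ^ 2 * (t ^ 2 + 1)
        + a * b * ((s ^ 2 + 1) / p * q + (t ^ 2 + 1) / q * p) := by gcongr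
    _ = _ := by
      linear_combination (-a ^ 2) * e1 - b ^ 2 * e2

theorem concaveOn_cot_theta (n : ℕ) :
    ConcaveOn ℝ {x : Fin (n + 1) → ℝ | theta x < π} (fun x => cos (theta x) / sin (theta x)) := by
  suffices H : ∀ x y : Fin (n + 1) → ℝ, theta x < π → theta y < π → ∀ a b : ℝ, 0 ≤ a → 0 ≤ b →
      a + b = 1 → theta (a • x + b • y) < π ∧
        a * (cos (theta x) / sin (theta x)) + b * (cos (theta y) / sin (theta y)) ≤
          cos (theta (a • x + b • y)) / sin (theta (a • x + b • y)) from
    ⟨fun x hx y hy a b ha hb hab => (H x y hx hy a b ha hb hab).1,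
      fun x hx y hy a b ha hb hab => (H x y hx hy a b ha hb hab).2⟩
  induction n with
  | zero =>
    intro x y _ _ a b _ _ _
    have h (z : Fin (0 + 1) → ℝ) : theta z = arccot (z 0) := by simp [theta]
    simp only [h, cos_div_sin_arccot]
    exact ⟨arccot_lt_pi _, le_rfl⟩
  | succ n ih =>
    intro x y hx hy a b ha hb hab
    have split (z : Fin (n + 1 + 1) → ℝ) (hz : theta (fun i => z (Fin.castSucc i)) < π) :=
      add_lt_pi_iff (theta_pos _) hz (arccot_pos (z (Fin.last _))) (arccot_lt_pi _)
    have init_lt (z : Fin (n + 1 + 1) → ℝ) (hz : theta z < π) :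
        theta (fun i => z (Fin.castSucc i)) < π := by
      rw [theta_succ] at hz
      linarith [arccot_pos (z (Fin.last _))]
    have cot_eq (z : Fin (n + 1 + 1) → ℝ) (hz : theta z < π) := by
      have hz' := hz
      rw [theta_succ] at hz'
      exact cot_add (sin_pos_of_pos_of_lt_pi (theta_pos _) (init_lt z hz)).ne'
        (sin_pos_of_pos_of_lt_pi (arccot_pos (z (Fin.last _))) (arccot_lt_pi _)).ne'
        (sin_pos_of_pos_of_lt_pi (add_pos (theta_pos _) (arccot_pos _)) hz').ne'
    simp only [← theta_succ, cos_div_sin_arccot] at split cot_eq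
    obtain ⟨hz, hle⟩ := ih _ _ (init_lt x hx) (init_lt y hy) a b ha hb hab
    have hp := (split x (init_lt x hx)).1 hx
    have hq := (split y (init_lt y hy)).1 hy
    change theta (fun i => (a • x + b • y) (Fin.castSucc i)) < π at hz
    change _ ≤ cos (theta (fun i => (a • x + b • y) (Fin.castSucc i))) /
      sin (theta (fun i => (a • x + b • y) (Fin.castSucc i))) at hle
    have hlast : (a • x + b • y) (Fin.last (n + 1)) =
        a * x (Fin.last (n + 1)) + b * y (Fin.last (n + 1)) := rfl
    have hlt : theta (a • x + b • y) < π := by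
      rw [split _ hz, hlast]
      have : 0 < a * (cos (theta fun i => x (Fin.castSucc i)) /
          sin (theta fun i => x (Fin.castSucc i)) + x (Fin.last (n + 1))) +
          b * (cos (theta fun i => y (Fin.castSucc i)) /
          sin (theta fun i => y (Fin.castSucc i)) + y (Fin.last (n + 1))) :=
        convex_Ioi (𝕜 := ℝ) (0 : ℝ) hp hq ha hb hab
      linarith
    refine ⟨hlt, ?_⟩
    rw [cot_eq x hx, cot_eq y hy, cot_eq _ hlt, hlast]
    have := sq_add_one_div_le (s := x (Fin.last (n + 1))) (t := y (Fin.last (n + 1)))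
      (r := cos (theta (fun i => (a • x + b • y) (Fin.castSucc i))) /
      sin (theta (fun i => (a • x + b • y) (Fin.castSucc i))) +
        (a * x (Fin.last (n + 1)) + b * y (Fin.last (n + 1)))) ha hb hab hp hq (by linarith)
    linarith

theorem stmt4 (n : ℕ) (hn : 1 ≤ n) (τ : ℝ) (hτ0 : 0 < τ) (hτπ : τ < π) :
    ConcaveOn ℝ {lam : Fin n → ℝ | theta lam < τ}
      (fun lam => Real.cos (theta lam) / Real.sin (theta lam)) := by
  obtain ⟨m, rfl⟩ := Nat.exists_eq_add_of_le' hn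
  have h := concaveOn_cot_theta m
  have hset : {lam : Fin (m + 1) → ℝ | theta lam < τ} =
      {lam ∈ {x : Fin (m + 1) → ℝ | theta x < π} |
        cos τ / sin τ < cos (theta lam) / sin (theta lam)} := by
    ext lam
    constructor
    · intro hl
      have hl' : theta lam < π := lt_trans hl hτπ
      exact ⟨hl', (lt_iff_cot_lt (theta_pos _) hl' hτ0 hτπ).1 hl⟩
    · rintro ⟨hl', hl⟩
      exact (lt_iff_cot_lt (theta_pos _) hl' hτ0 hτπ).2 hl
  exact h.subset (fun lam hl => lt_trans hl hτπ) (hset ▸ h.convex_gt _)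
end

section
/- Let n ≥ 1 and let λ = (λ_1, …, λ_n) ∈ ℝ^n satisfy 0 < θ(λ) < π. Then for every vector v = (v_1, …, v_n) ∈ ℝ^n, Σ_{i,j=1}^n H_{ij} v_i v_j ≤ 0, where H_{ij} = −2·csc²(θ(λ))·λ_i·δ_{ij}/(1 + λ_i²)² + 2·csc²(θ(λ))·cot(θ(λ)) / ((1 + λ_i²)(1 + λ_j²)) is the Hessian matrix of λ ↦ cot(θ(λ)) at λ; i.e. this Hessian is negative semidefinite at every point of Γ_π. -/
open Real

/-- The quadratic form `cot α x² + cot β y² - cot (α + β) (x + y)²` is positive semidefinite. -/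
theorem cot_add_mul_sq_le {α β : ℝ} (hα : 0 < α) (hβ : 0 < β) (h : α + β < π) (x y : ℝ) :
    Real.cot (α + β) * (x + y) ^ 2 ≤ Real.cot α * x ^ 2 + Real.cot β * y ^ 2 := by
  have hp : 0 < sin α := sin_pos_of_pos_of_lt_pi hα (by linarith)
  have hq : 0 < sin β := sin_pos_of_pos_of_lt_pi hβ (by linarith)
  have hs : 0 < sin (α + β) := sin_pos_of_pos_of_lt_pi (by linarith) h
  have h1 : cos α * sin (α + β) - cos (α + β) * sin α = sin β := by
    rw [sin_add, cos_add]; linear_combination sin β * sin_sq_add_cos_sq α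
  have h2 : cos β * sin (α + β) - cos (α + β) * sin β = sin α := by
    rw [sin_add, cos_add]; linear_combination sin α * sin_sq_add_cos_sq β
  have key : Real.cot α * x ^ 2 + Real.cot β * y ^ 2 - Real.cot (α + β) * (x + y) ^ 2
      = ((sin β * x - cos (α + β) * sin α * y) ^ 2 + (sin (α + β) * sin α * y) ^ 2)
        / (sin α * sin β * sin (α + β)) := by
    simp only [Real.cot_eq_cos_div_sin]
    field_simp
    linear_combination x ^ 2 * sin β * h1 + y ^ 2 * sin α * h2
      - y ^ 2 * sin α ^ 2 * sin_sq_add_cos_sq (α + β)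
  have : 0 ≤ ((sin β * x - cos (α + β) * sin α * y) ^ 2 + (sin (α + β) * sin α * y) ^ 2)
      / (sin α * sin β * sin (α + β)) := by positivity
  linarith

theorem cot_sum_mul_sq_sum_le {ι : Type*} {s : Finset ι} (hs : s.Nonempty) {a : ι → ℝ}
    (ha : ∀ i, 0 < a i) (w : ι → ℝ) (h : ∑ i ∈ s, a i < π) :
    Real.cot (∑ i ∈ s, a i) * (∑ i ∈ s, w i) ^ 2 ≤ ∑ i ∈ s, Real.cot (a i) * w i ^ 2 := by
  induction hs using Finset.Nonempty.cons_induction with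
  | singleton i => simp
  | cons i s hi hs ih =>
    simp only [Finset.sum_cons] at h ⊢
    have hpos : 0 < ∑ i ∈ s, a i := Finset.sum_pos (fun j _ => ha j) hs
    linarith [cot_add_mul_sq_le (ha i) hpos h (w i) (∑ i ∈ s, w i), ih (by linarith [ha i])]

theorem cot_arccot (x : ℝ) : Real.cot (arccot x) = x := by
  rw [← Real.tan_inv_eq_cot, arccot, Real.tan_pi_div_two_sub, inv_inv, Real.tan_arctan]

/-- The Hessian matrix of `λ ↦ cot (θ(λ))` is negative semidefinite on `Γ_π`. -/
theorem stmt10 (n : ℕ) (hn : 1 ≤ n) (lam : Fin n → ℝ)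
    (h0 : 0 < theta lam) (hπ : theta lam < π) (v : Fin n → ℝ) :
    ∑ i, ∑ j,
      (-2 * (1 / Real.sin (theta lam)) ^ 2 * lam i * (if i = j then 1 else 0)
          / (1 + lam i ^ 2) ^ 2
        + 2 * (1 / Real.sin (theta lam)) ^ 2 * Real.cot (theta lam)
          / ((1 + lam i ^ 2) * (1 + lam j ^ 2))) * v i * v j ≤ 0 := by
  have : Nonempty (Fin n) := ⟨⟨0, hn⟩⟩
  have key := cot_sum_mul_sq_sum_le Finset.univ_nonempty (fun i => arccot_pos (lam i))
    (fun i => v i / (1 + lam i ^ 2)) hπ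
  simp only [cot_arccot] at key
  change Real.cot (theta lam) * _ ≤ _ at key
  set c := (1 / Real.sin (theta lam)) ^ 2
  have hc0 : 0 ≤ c := sq_nonneg _
  have hsum : ∑ i, ∑ j,
      (-2 * c * lam i * (if i = j then 1 else 0) / (1 + lam i ^ 2) ^ 2
        + 2 * c * Real.cot (theta lam) / ((1 + lam i ^ 2) * (1 + lam j ^ 2))) * v i * v j
      = 2 * c * (Real.cot (theta lam) * (∑ i, v i / (1 + lam i ^ 2)) ^ 2
        - ∑ i, lam i * (v i / (1 + lam i ^ 2)) ^ 2) := by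
    rw [sq (∑ i, _), Finset.sum_mul_sum, mul_sub, Finset.mul_sum, Finset.mul_sum, Finset.mul_sum,
      ← Finset.sum_sub_distrib]
    refine Finset.sum_congr rfl fun i _ => ?_
    simp only [add_mul, Finset.sum_add_distrib, mul_ite, ite_mul, ite_div, mul_one, mul_zero,
      zero_div, zero_mul, Finset.sum_ite_eq, Finset.mem_univ, if_true]
    rw [add_comm, sub_eq_add_neg, Finset.mul_sum, Finset.mul_sum]
    congr 1
    · refine Finset.sum_congr rfl fun j _ => ?_
      rw [div_mul_div_comm]
      ring
    · rw [div_pow]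
      ring
  rw [hsum]
  exact mul_nonpos_of_nonneg_of_nonpos (by positivity) (sub_nonpos.2 key)
end
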